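/- Let m be even, let α, β ∈ 𝔽_{q^m} with α ≠ 0 and β ≠ 0, let λ ∈ 𝔽_q with λ ≠ 0, and set N₃ = Σ_{a,b ∈ 𝔽_{q^m}} Σ_{x ∈ 𝔽_q\{0}} Σ_{y ∈ 𝔽_q\{0}} Σ_{z ∈ 𝔽_q\{0}} ζ_q^{x·Tr(a²)} · ζ_q^{y·Tr(b²)} · ζ_q^{z·Tr(αb + βa) − zλ} ∈ ℂ. Then: N₃ = −(q−1)²·G² if Tr(α²) = 0 and Tr(β²) = 0; N₃ = (q−1)·G² if exactly one of Tr(α²), Tr(β²) is 0; and N₃ = −G² if Tr(α²) ≠ 0 and Tr(β²) ≠ 0. -/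

import Mathlib

open Finset

/-- The additive character `s ↦ exp(2πi·s̃/q)` of `ZMod q`. -/
noncomputable def zetaQ (q : ℕ) (s : ZMod q) : ℂ :=
  Complex.exp (2 * Real.pi * Complex.I * (s.val : ℂ) / (q : ℂ))

/-- The quadratic Gauss sum `G` over the big field `F`. -/
noncomputable def gaussBig (q : ℕ) [Fact q.Prime] (F : Type*) [Field F] [Fintype F]
    [DecidableEq F] [Algebra (ZMod q) F] : ℂ :=
  ∑ x ∈ Finset.univ.filter (fun x : F => x ≠ 0),
    (quadraticChar F x : ℂ) * zetaQ q (Algebra.trace (ZMod q) F x)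

/-- The quadratic Gauss sum `Ḡ` over the prime field `ZMod q`. -/
noncomputable def gaussSmall (q : ℕ) [Fact q.Prime] : ℂ :=
  ∑ y ∈ Finset.univ.filter (fun y : ZMod q => y ≠ 0),
    (quadraticChar (ZMod q) y : ℂ) * zetaQ q y

/-- The character sum `N₃` of Lemma 3.4. -/
noncomputable def Nthree (q : ℕ) [Fact q.Prime] (F : Type*) [Field F] [Fintype F]
    [DecidableEq F] [Algebra (ZMod q) F] (α β : F) (lam : ZMod q) : ℂ :=
  ∑ a : F, ∑ b : F, ∑ x ∈ Finset.univ.filter (fun x : ZMod q => x ≠ 0),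
    ∑ y ∈ Finset.univ.filter (fun y : ZMod q => y ≠ 0),
      ∑ z ∈ Finset.univ.filter (fun z : ZMod q => z ≠ 0),
        zetaQ q (x * Algebra.trace (ZMod q) F (a ^ 2)) *
          zetaQ q (y * Algebra.trace (ZMod q) F (b ^ 2)) *
          zetaQ q (z * Algebra.trace (ZMod q) F (α * b + β * a) - z * lam)

theorem zetaQ_eq_stdAddChar (q : ℕ) [Fact q.Prime] (s : ZMod q) :
    zetaQ q s = ZMod.stdAddChar s := by
  rw [ZMod.stdAddChar_apply, ZMod.toCircle_apply, zetaQ]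

theorem sum_sum_sum_rotate {ι κ M : Type*} [Fintype ι] [AddCommMonoid M]
    (s : Finset κ) (f : ι → ι → κ → M) :
    ∑ a, ∑ b, ∑ x ∈ s, f a b x = ∑ x ∈ s, ∑ a, ∑ b, f a b x :=
  (sum_congr rfl fun _ _ => sum_comm).trans sum_comm

theorem sum_ne_zero_stdAddChar_mul (q : ℕ) [Fact q.Prime] (c : ZMod q) (hc : c ≠ 0) :
    ∑ z ∈ univ.filter (fun z : ZMod q => z ≠ 0), ZMod.stdAddChar (c * z) = (-1 : ℂ) := by
  have h : ∑ z : ZMod q, (ZMod.stdAddChar (c * z) : ℂ) = 0 := by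
    have := AddChar.sum_mulShift c (ZMod.isPrimitive_stdAddChar q)
    simpa [hc, mul_comm] using this
  rw [filter_ne', ← sum_erase_add _ _ (mem_univ (0 : ZMod q))] at *
  simp only [mul_zero, AddChar.map_zero_eq_one] at h
  linear_combination h

theorem sum_ne_zero_stdAddChar_mul_inv (q : ℕ) [Fact q.Prime] (c : ZMod q) :
    ∑ z ∈ univ.filter (fun z : ZMod q => z ≠ 0), ZMod.stdAddChar (c * z⁻¹) =
      if c = 0 then (q : ℂ) - 1 else -1 := by
  split_ifs with hc
  · have : 1 ≤ q := (Fact.out : q.Prime).one_lt.le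
    simp [hc, filter_ne', card_erase_of_mem, ZMod.card, Nat.cast_sub this]
  · rw [← sum_ne_zero_stdAddChar_mul q c hc]
    refine sum_nbij' (fun x => x⁻¹) (fun x => x⁻¹) ?_ ?_ ?_ ?_ ?_ <;> simp

theorem isSquare_algebraMap_of_even (q m : ℕ) [Fact q.Prime] (hq : Odd q) (hm : Even m)
    (F : Type*) [Field F] [Fintype F] [Algebra (ZMod q) F] (hF : Fintype.card F = q ^ m)
    (x : ZMod q) (hx : x ≠ 0) : IsSquare (algebraMap (ZMod q) F x) := by
  have hodd : Odd (Fintype.card F) := hF ▸ hq.pow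
  have hchar : ringChar F ≠ 2 := by
    intro h
    have := FiniteField.even_card_of_char_two h
    rw [Nat.odd_iff] at hodd
    omega
  rw [FiniteField.isSquare_iff hchar (by simpa using hx), ← map_pow]
  obtain ⟨k, rfl⟩ := hm
  obtain ⟨c, hc⟩ : q - 1 ∣ q ^ k - 1 := by simpa using Nat.sub_dvd_pow_sub_pow q 1 k
  obtain ⟨d, hd⟩ := (hq.pow (n := k))
  have h2 : Fintype.card F / 2 = (q - 1) * (c * (d + 1)) := by
    have h1 : q ^ k - 1 = 2 * d := by omega
    rw [hF, pow_add, ← mul_assoc, ← hc, h1, hd]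
    have : (2 * d + 1) * (2 * d + 1) = 2 * (2 * d * (d + 1)) + 1 := by ring
    omega
  rw [h2, pow_mul, ZMod.pow_card_sub_one_eq_one hx, one_pow, map_one]

/-- The sum of a nontrivial additive character over squares is a quadratic Gauss sum. -/
theorem sum_addChar_sq {F : Type*} [Field F] [Fintype F] [DecidableEq F]
    (hF : ringChar F ≠ 2) (ψ : AddChar F ℂ) (hψ : ψ ≠ 0) :
    ∑ a : F, ψ (a ^ 2) = ∑ c : F, (quadraticChar F c : ℂ) * ψ c := by
  have h0 : ∑ c : F, ψ c = 0 := by simpa [hψ] using AddChar.sum_eq_ite ψ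
  calc ∑ a : F, ψ (a ^ 2) = ∑ c : F, ∑ a : F with a ^ 2 = c, ψ (a ^ 2) :=
        (sum_fiberwise _ _ _).symm
    _ = ∑ c : F, ((quadraticChar F c : ℂ) + 1) * ψ c := by
        refine sum_congr rfl fun c _ => ?_
        have h := quadraticChar_card_sqrts hF c
        rw [sum_congr rfl (g := fun _ => ψ c) (by simp +contextual), sum_const, nsmul_eq_mul]
        congr 1
        have h' : (univ.filter fun a : F => a ^ 2 = c) = {x : F | x ^ 2 = c}.toFinset := by
          ext; simp
        rw [h']
        exact_mod_cast h
    _ = _ := by simp [add_mul, sum_add_distrib, h0]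

/-- The additive character of `F` obtained from the standard one of `ZMod q` via the trace. -/
noncomputable def traceChar (q : ℕ) [Fact q.Prime] (F : Type*) [Field F]
    [Algebra (ZMod q) F] : AddChar F ℂ :=
  (ZMod.stdAddChar (N := q)).compAddMonoidHom (Algebra.trace (ZMod q) F).toAddMonoidHom

theorem traceChar_apply (q : ℕ) [Fact q.Prime] (F : Type*) [Field F]
    [Algebra (ZMod q) F] (a : F) :
    traceChar q F a = ZMod.stdAddChar (Algebra.trace (ZMod q) F a) := rfl

theorem traceChar_ne_zero (q : ℕ) [Fact q.Prime] (F : Type*) [Field F] [Finite F]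
    [Algebra (ZMod q) F] : traceChar q F ≠ 0 := by
  intro h
  obtain ⟨a, ha⟩ := Algebra.trace_surjective (ZMod q) F 1
  have h1 : traceChar q F a = 1 := by simp [h]
  rw [traceChar_apply, ha, ← AddChar.map_zero_eq_one (ZMod.stdAddChar (N := q))] at h1
  exact one_ne_zero (ZMod.injective_stdAddChar h1)

theorem sum_traceChar_sq (q : ℕ) [Fact q.Prime] (F : Type*) [Field F] [Fintype F]
    [DecidableEq F] [Algebra (ZMod q) F] (hF : ringChar F ≠ 2) :
    ∑ a : F, traceChar q F (a ^ 2) = gaussBig q F := by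
  rw [sum_addChar_sq hF _ (traceChar_ne_zero q F), gaussBig]
  simp only [zetaQ_eq_stdAddChar, traceChar_apply]
  rw [filter_ne', sum_erase]
  simp

theorem sum_traceChar_quadratic (q : ℕ) [Fact q.Prime] (F : Type*) [Field F] [Fintype F]
    [DecidableEq F] [Algebra (ZMod q) F] (hF : ringChar F ≠ 2) (x β : F) (hx : x ≠ 0)
    (hsq : IsSquare x) :
    ∑ a : F, traceChar q F (x * a ^ 2 + β * a) =
      gaussBig q F * traceChar q F (-(β ^ 2 * (4 * x)⁻¹)) := by
  obtain ⟨w, rfl⟩ := hsq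
  have hw : w ≠ 0 := by rintro rfl; simp at hx
  have h2 : (2 : F) ≠ 0 := Ring.two_ne_zero hF
  have h4 : (4 : F) ≠ 0 := by
    rw [show (4 : F) = 2 * 2 by norm_num]; exact mul_ne_zero h2 h2
  rw [← sum_traceChar_sq q F hF, sum_mul]
  refine Fintype.sum_equiv ((Equiv.mulLeft₀ w hw).trans (Equiv.addRight (β / (2 * w)))) _ _ ?_
  intro a
  rw [← AddChar.map_add_eq_mul]
  congr 1
  simp only [Equiv.trans_apply, Equiv.mulLeft₀_apply, Equiv.coe_addRight]
  field_simp
  ring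

theorem Nthree_eq (q m : ℕ) [Fact q.Prime] (hq : Odd q) (hmeven : Even m)
    (F : Type*) [Field F] [Fintype F] [DecidableEq F] [Algebra (ZMod q) F]
    (hF : Fintype.card F = q ^ m) (α β : F) (lam : ZMod q) (hlam : lam ≠ 0) :
    Nthree q F α β lam = -gaussBig q F ^ 2 *
      (if Algebra.trace (ZMod q) F (α ^ 2) = 0 then (q : ℂ) - 1 else -1) *
      (if Algebra.trace (ZMod q) F (β ^ 2) = 0 then (q : ℂ) - 1 else -1) := by
  have hodd : Odd (Fintype.card F) := hF ▸ hq.pow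
  have hchar : ringChar F ≠ 2 := by
    intro h
    have := FiniteField.even_card_of_char_two h
    rw [Nat.odd_iff] at hodd
    omega
  have h2 : (2 : ZMod q) ≠ 0 := by
    intro h
    apply Ring.two_ne_zero hchar
    rw [← map_ofNat (algebraMap (ZMod q) F) 2, h, map_zero]
  have h4 : (4 : ZMod q) ≠ 0 := by
    rw [show (4 : ZMod q) = 2 * 2 by norm_num]; exact mul_ne_zero h2 h2
  have key (x z : ZMod q) (hx : x ≠ 0) (γ : F) :
      ∑ a : F, traceChar q F (algebraMap (ZMod q) F x * a ^ 2 + algebraMap (ZMod q) F z * γ * a) =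
        gaussBig q F *
          ZMod.stdAddChar (-(z ^ 2 * 4⁻¹ * Algebra.trace (ZMod q) F (γ ^ 2)) * x⁻¹) := by
    rw [sum_traceChar_quadratic q F hchar _ _ (by simpa using hx)
      (isSquare_algebraMap_of_even q m hq hmeven F hF x hx), traceChar_apply]
    congr 2
    have : -((algebraMap (ZMod q) F z * γ) ^ 2 * (4 * algebraMap (ZMod q) F x)⁻¹) =
        (-(z ^ 2 * 4⁻¹ * x⁻¹)) • γ ^ 2 := by
      rw [Algebra.smul_def]
      simp only [map_neg, map_mul, map_pow, map_inv₀, map_ofNat, mul_inv]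
      ring
    rw [this, map_smul, smul_eq_mul]
    ring
  have inner (z : ZMod q) (hz : z ≠ 0) (γ : F) :
      ∑ x ∈ univ.filter (fun x : ZMod q => x ≠ 0),
        (ZMod.stdAddChar (-(z ^ 2 * 4⁻¹ * Algebra.trace (ZMod q) F (γ ^ 2)) * x⁻¹) : ℂ) =
      if Algebra.trace (ZMod q) F (γ ^ 2) = 0 then (q : ℂ) - 1 else -1 := by
    rw [sum_ne_zero_stdAddChar_mul_inv]
    simp [hz, h4]
  have term (a b : F) (x y z : ZMod q) :
      zetaQ q (x * Algebra.trace (ZMod q) F (a ^ 2)) *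
          zetaQ q (y * Algebra.trace (ZMod q) F (b ^ 2)) *
          zetaQ q (z * Algebra.trace (ZMod q) F (α * b + β * a) - z * lam) =
        ZMod.stdAddChar (-lam * z) *
        (traceChar q F (algebraMap (ZMod q) F x * a ^ 2 + algebraMap (ZMod q) F z * β * a) *
        traceChar q F (algebraMap (ZMod q) F y * b ^ 2 + algebraMap (ZMod q) F z * α * b)) := by
    simp only [zetaQ_eq_stdAddChar, traceChar_apply, ← AddChar.map_add_eq_mul]
    congr 1
    simp only [← Algebra.smul_def, smul_mul_assoc, map_add, map_smul, smul_eq_mul]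
    ring
  simp only [Nthree, term]
  rw [sum_sum_sum_rotate]
  simp only [sum_sum_sum_rotate]
  have step (x y z : ZMod q) (hx : x ≠ 0) (hy : y ≠ 0) := by
    have := congrArg₂ (· * ·) (key x z hx β) (key y z hy α)
    simpa only [sum_mul_sum] using this
  calc _ = ∑ x ∈ univ.filter (fun x : ZMod q => x ≠ 0),
        ∑ y ∈ univ.filter (fun y : ZMod q => y ≠ 0),
        ∑ z ∈ univ.filter (fun z : ZMod q => z ≠ 0), ZMod.stdAddChar (-lam * z) *
          ((gaussBig q F *
            ZMod.stdAddChar (-(z ^ 2 * 4⁻¹ * Algebra.trace (ZMod q) F (β ^ 2)) * x⁻¹)) *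
          (gaussBig q F *
            ZMod.stdAddChar (-(z ^ 2 * 4⁻¹ * Algebra.trace (ZMod q) F (α ^ 2)) * y⁻¹))) := by
        refine sum_congr rfl fun x hx => sum_congr rfl fun y hy => sum_congr rfl fun z _ => ?_
        rw [← step x y z (mem_filter.mp hx).2 (mem_filter.mp hy).2]
        simp only [mul_sum]
    _ = ∑ z ∈ univ.filter (fun z : ZMod q => z ≠ 0), gaussBig q F ^ 2 *
          ZMod.stdAddChar (-lam * z) *
          ((∑ x ∈ univ.filter (fun x : ZMod q => x ≠ 0),
            ZMod.stdAddChar (-(z ^ 2 * 4⁻¹ * Algebra.trace (ZMod q) F (β ^ 2)) * x⁻¹)) *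
          ∑ y ∈ univ.filter (fun y : ZMod q => y ≠ 0),
            ZMod.stdAddChar (-(z ^ 2 * 4⁻¹ * Algebra.trace (ZMod q) F (α ^ 2)) * y⁻¹)) := by
        rw [(sum_congr rfl fun _ _ => sum_comm).trans sum_comm]
        refine sum_congr rfl fun z _ => ?_
        rw [sum_mul_sum]
        simp only [mul_sum]
        refine sum_congr rfl fun x _ => sum_congr rfl fun y _ => ?_
        ring
    _ = ∑ z ∈ univ.filter (fun z : ZMod q => z ≠ 0), ZMod.stdAddChar (-lam * z) *
          (gaussBig q F ^ 2 *
          ((if Algebra.trace (ZMod q) F (β ^ 2) = 0 then (q : ℂ) - 1 else -1) *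
          (if Algebra.trace (ZMod q) F (α ^ 2) = 0 then (q : ℂ) - 1 else -1))) := by
        refine sum_congr rfl fun z hz => ?_
        rw [inner z (mem_filter.mp hz).2, inner z (mem_filter.mp hz).2]
        ring
    _ = _ := by
        rw [← sum_mul, sum_ne_zero_stdAddChar_mul q (-lam) (neg_ne_zero.mpr hlam)]
        ring

theorem stmt4 (q m : ℕ) [Fact q.Prime] (hq : Odd q) (hm : 2 ≤ m) (hmeven : Even m)
    (F : Type*) [Field F] [Fintype F] [DecidableEq F] [Algebra (ZMod q) F]
    (hF : Fintype.card F = q ^ m) (α β : F) (hα : α ≠ 0) (hβ : β ≠ 0)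
    (lam : ZMod q) (hlam : lam ≠ 0) :
    (Algebra.trace (ZMod q) F (α ^ 2) = 0 → Algebra.trace (ZMod q) F (β ^ 2) = 0 →
      Nthree q F α β lam = -((q : ℂ) - 1) ^ 2 * (gaussBig q F) ^ 2) ∧
    ((Algebra.trace (ZMod q) F (α ^ 2) = 0 ∧ Algebra.trace (ZMod q) F (β ^ 2) ≠ 0) ∨
     (Algebra.trace (ZMod q) F (α ^ 2) ≠ 0 ∧ Algebra.trace (ZMod q) F (β ^ 2) = 0) →
      Nthree q F α β lam = ((q : ℂ) - 1) * (gaussBig q F) ^ 2) ∧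
    (Algebra.trace (ZMod q) F (α ^ 2) ≠ 0 → Algebra.trace (ZMod q) F (β ^ 2) ≠ 0 →
      Nthree q F α β lam = -(gaussBig q F) ^ 2) := by
  rw [Nthree_eq q m hq hmeven F hF α β lam hlam]
  refine ⟨fun h h' => ?_, ?_, fun h h' => ?_⟩
  · rw [if_pos h, if_pos h']
    ring
  · rintro (⟨h, h'⟩ | ⟨h, h'⟩)
    · rw [if_pos h, if_neg h']
      ring
    · rw [if_neg h, if_pos h']
      ring
  · rw [if_neg h, if_neg h']
    ring
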